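/- For all integers m, n, t > 0 and all integers a, b with 0 ≤ b ≤ a ≤ n−t and mn−b−1 ≠ 0, the number of positive (m,t)-Schröder paths S of height n with dg(S) = a and cd(S) = b equals ( (t+a)/n − m(a−b)/(mn−b−1) ) · C(mn−b−1, a−b)·C(mn+n−t−a−1, n−t−a), as an identity in ℚ. -/

import Mathlib

/-- A step of a lattice path: north `(0,1)`, east `(1,0)` or diagonal `(1,1)`. -/
inductive Step : Type
  | N : Step
  | E : Step
  | D : Step
  deriving DecidableEq

/-- The displacement vector of a step. -/
def stepVec : Step → ℤ × ℤ
  | .N => (0, 1)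
  | .E => (1, 0)
  | .D => (1, 1)

/-- The lattice point reached after the first `k` steps of the path `P` (starting at the
origin). -/
def pt (P : List Step) (k : ℕ) : ℤ × ℤ := ((P.take k).map stepVec).sum

/-- The path `P` starts with at least `t` north steps. -/
def StartsNorth (t : ℤ) (P : List Step) : Prop := List.replicate t.toNat Step.N <+: P

/-- The path `P` stays weakly above the line `x = m·y`. -/
def AboveLine (m : ℤ) (P : List Step) : Prop := ∀ k : ℕ, (pt P k).1 ≤ m * (pt P k).2

/-- An `(m,t)`-Schröder path of height `n`: a lattice path from `(0,0)` to `(mn,n)` using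
north, east and diagonal steps, starting with at least `t` north steps and never going
below the line `x = m·y`. -/
def IsSchroeder (m n t : ℤ) (P : List Step) : Prop :=
  StartsNorth t P ∧ pt P P.length = (m * n, n) ∧ AboveLine m P

/-- An `(m,t)`-Dyck path of height `n`: an `(m,t)`-Schröder path of height `n` with no
diagonal steps. -/
def IsDyck (m n t : ℤ) (P : List Step) : Prop :=
  IsSchroeder m n t P ∧ ∀ s ∈ P, s ≠ Step.D

/-- A Schröder path is small if none of its diagonal steps starts on the line `x = m·y`. -/
def IsSmall (m : ℤ) (P : List Step) : Prop :=
  ∀ j : ℕ, P[j]? = some Step.D → (pt P j).1 ≠ m * (pt P j).2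

/-- A Schröder path is positive if it touches the line `x = m·y` only at its two
endpoints. -/
def IsPositive (m : ℤ) (P : List Step) : Prop :=
  ∀ k : ℕ, 0 < k → k < P.length → (pt P k).1 ≠ m * (pt P k).2

/-- The set of indices `j` such that the `j`-th step of `P` is east and the `(j+1)`-st is
north; the corresponding valley point is `pt P (j+1)`. -/
def valleys (P : List Step) : Finset ℕ :=
  (Finset.range P.length).filter fun j => P[j]? = some Step.E ∧ P[j + 1]? = some Step.N

/-- The number of valleys of `P`. -/
def val (P : List Step) : ℕ := (valleys P).card

/-- The number of valleys of `P` whose `x`-coordinate is congruent to `i` modulo `m`. -/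
def ival (m i : ℤ) (P : List Step) : ℕ :=
  ((valleys P).filter fun j => (pt P (j + 1)).1 % m = i % m).card

/-- The set of returns of `P`: valleys of the form `(m·i, i)`. -/
def returns (m : ℤ) (P : List Step) : Finset ℕ :=
  (valleys P).filter fun j => (pt P (j + 1)).1 = m * (pt P (j + 1)).2

/-- The number of returns of `P`. -/
def ret (m : ℤ) (P : List Step) : ℕ := (returns m P).card

/-- The set of indices of diagonal steps of `P`. -/
def diags (P : List Step) : Finset ℕ :=
  (Finset.range P.length).filter fun j => P[j]? = some Step.D

/-- The number of diagonal steps of `P`. -/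
def dg (P : List Step) : ℕ := (diags P).card

/-- A Schröder path is `m`-divisible if every diagonal step ends at an `x`-coordinate
divisible by `m`. -/
def MDivisible (m : ℤ) (P : List Step) : Prop :=
  ∀ j ∈ diags P, m ∣ (pt P (j + 1)).1

/-- The number of cornered diagonal steps of `P`: diagonal steps connecting `(i·m − 1, i)`
to `(i·m, i + 1)` for some `i`. -/
def cd (m : ℤ) (P : List Step) : ℕ :=
  ((diags P).filter fun j => (pt P (j + 1)).1 = m * ((pt P (j + 1)).2 - 1)).card

/-- The generalized binomial coefficient `C(p,q) = p(p−1)⋯(p−q+1)/q!` for integers `p` and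
`q ≥ 0`, and `C(p,q) = 0` for `q < 0`. -/
def C (p q : ℤ) : ℤ :=
  if q < 0 then 0
  else if 0 ≤ p then (p.toNat.choose q.toNat : ℤ)
  else (-1) ^ q.toNat * ((q - p - 1).toNat.choose q.toNat : ℤ)

/-- The change of the excess `m·y - x` along a step. -/
def rise (m : ℤ) : Step → ℤ
  | .N => m
  | .E => -1
  | .D => m - 1

/-- Started at excess `h`, the path `P` reaches excess `0` for the first time at its end. -/
def FirstPassage (m : ℤ) : ℤ → List Step → Prop
  | h, [] => h = 0
  | h, s :: l => 0 < h ∧ FirstPassage m (h + rise m s) l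

/-- The number of diagonal steps of `P` that start at excess `1`, when `P` starts at excess `h`. -/
def cornered (m : ℤ) : ℤ → List Step → ℕ
  | _, [] => 0
  | h, s :: l => (if s = Step.D ∧ h = 1 then 1 else 0) + cornered m (h + rise m s) l

lemma pt_zero (P : List Step) : pt P 0 = 0 := by simp [pt]

lemma pt_cons_succ (s : Step) (l : List Step) (k : ℕ) :
    pt (s :: l) (k + 1) = stepVec s + pt l k := by simp [pt]

lemma rise_eq (m : ℤ) (s : Step) : rise m s = m * (stepVec s).2 - (stepVec s).1 := by
  cases s <;> simp [rise, stepVec]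

lemma firstPassage_iff (m h : ℤ) (l : List Step) :
    FirstPassage m h l ↔
      (∀ k < l.length, 0 < h + (m * (pt l k).2 - (pt l k).1)) ∧
        h + (m * (pt l l.length).2 - (pt l l.length).1) = 0 := by
  induction l generalizing h with
  | nil => simp [FirstPassage, pt]
  | cons s l ih =>
    have key : ∀ k, h + (m * (pt (s :: l) (k + 1)).2 - (pt (s :: l) (k + 1)).1)
        = h + rise m s + (m * (pt l k).2 - (pt l k).1) := by
      intro k
      rw [pt_cons_succ, rise_eq, Prod.fst_add, Prod.snd_add]
      ring
    rw [FirstPassage, ih, List.length_cons, key]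
    constructor
    · rintro ⟨h0, h1, h2⟩
      refine ⟨fun k hk => ?_, h2⟩
      cases k with
      | zero => simpa [pt_zero] using h0
      | succ k => rw [key]; exact h1 k (by omega)
    · rintro ⟨h1, h2⟩
      refine ⟨by simpa [pt_zero] using h1 0 (by omega), fun k hk => ?_, h2⟩
      rw [← key]
      exact h1 (k + 1) (by omega)

lemma pt_length (P : List Step) :
    pt P P.length = ((P.count .E : ℤ) + P.count .D, (P.count .N : ℤ) + P.count .D) := by
  induction P with
  | nil => rfl
  | cons s l ih =>
    rw [List.length_cons, pt_cons_succ, ih]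
    cases s <;> refine Prod.ext ?_ ?_ <;> simp [stepVec] <;> ring

lemma card_filter_range_succ (n : ℕ) (p : ℕ → Prop) [DecidablePred p] :
    ((Finset.range (n + 1)).filter p).card
      = (if p 0 then 1 else 0) + ((Finset.range n).filter fun j => p (j + 1)).card := by
  rw [Finset.card_filter, Finset.card_filter, Finset.sum_range_succ', add_comm]

lemma dg_eq_count (P : List Step) : dg P = P.count .D := by
  induction P with
  | nil => simp [dg, diags]
  | cons s l ih =>
    rw [List.count_cons, ← ih, dg, diags, List.length_cons, card_filter_range_succ]
    simp [dg, diags, add_comm]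

lemma card_diags_filter_eq_cornered (m h : ℤ) (P : List Step) :
    ((diags P).filter fun j => h + (m * (pt P (j + 1)).2 - (pt P (j + 1)).1) = m).card
      = cornered m h P := by
  induction P generalizing h with
  | nil => simp [cornered, diags]
  | cons s l ih =>
    rw [cornered, ← ih, diags, diags, Finset.filter_filter, Finset.filter_filter,
      List.length_cons, card_filter_range_succ]
    congr 1
    · refine if_congr ?_ rfl rfl
      cases s <;> simp [pt_cons_succ, pt_zero, stepVec]
      constructor <;> intro <;> linarith
    · congr 1
      refine Finset.filter_congr fun j _ => ?_
      rw [pt_cons_succ s l (j + 1), rise_eq, Prod.fst_add, Prod.snd_add]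
      simp only [List.getElem?_cons_succ]
      refine and_congr_right fun _ => ?_
      constructor <;> intro <;> linarith

lemma cd_eq_cornered (m : ℤ) (P : List Step) : cd m P = cornered m 0 P := by
  rw [← card_diags_filter_eq_cornered, cd]
  congr 1
  refine Finset.filter_congr fun j _ => ?_
  constructor <;> intro <;> linarith

lemma cornered_le_count (m h : ℤ) (P : List Step) : cornered m h P ≤ P.count .D := by
  induction P generalizing h with
  | nil => simp [cornered]
  | cons s l ih =>
    have := ih (h + rise m s)
    cases s
    · simpa [cornered] using this
    · simpa [cornered] using this
    · rw [cornered, List.count_cons_self]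
      split_ifs <;> omega

/-- First-passage paths from excess `h` with `y` north steps, `d` diagonal steps that are not
cornered and `c` cornered diagonal steps. -/
def passages (m h y d c : ℤ) : Set (List Step) :=
  {l | FirstPassage m h l ∧ (l.count .N : ℤ) = y ∧ (l.count .D : ℤ) = d + c ∧
    (cornered m h l : ℤ) = c}

lemma passages_eq_empty {m h y d c : ℤ} (hneg : y < 0 ∨ d < 0 ∨ c < 0) :
    passages m h y d c = ∅ := by
  refine Set.eq_empty_of_forall_notMem fun l hl => ?_
  obtain ⟨-, h1, h2, h3⟩ := hl
  have := cornered_le_count m h l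
  omega

lemma passages_zero (m y d c : ℤ) :
    passages m 0 y d c = if y = 0 ∧ d = 0 ∧ c = 0 then {[]} else ∅ := by
  ext l
  cases l with
  | nil =>
    split_ifs with hz
    · obtain ⟨rfl, rfl, rfl⟩ := hz
      simp [passages, FirstPassage, cornered]
    · simp only [passages, FirstPassage, cornered, Set.mem_ofPred_eq, List.count_nil,
        Set.mem_empty_iff_false, iff_false]
      push_cast
      omega
  | cons s l => split_ifs <;> simp [passages, FirstPassage]

lemma passages_eq_union {m h : ℤ} (hh : 0 < h) (y d c : ℤ) :
    passages m h y d c =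
      List.cons .N '' passages m (h + m) (y - 1) d c ∪
        (List.cons .E '' passages m (h - 1) y d c ∪
          List.cons .D '' (if h = 1 then passages m (h + m - 1) y d (c - 1)
            else passages m (h + m - 1) y (d - 1) c)) := by
  ext l
  cases l with
  | nil => simp [passages, FirstPassage]; omega
  | cons s l =>
    cases s
    · simp only [passages, FirstPassage, cornered, rise, Set.mem_union, Set.mem_image,
        Set.mem_ofPred_eq, List.cons.injEq]
      simp [hh, eq_sub_iff_add_eq]
    · simp [passages, FirstPassage, cornered, rise, hh, sub_eq_add_neg]
    · split_ifs with h1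
      · simp [passages, FirstPassage, cornered, rise, h1]
        intro _ _
        omega
      · simp [passages, FirstPassage, cornered, rise, h1, hh, ← add_sub_assoc]
        intro _ _
        omega

/-- Binomial coefficients with integer arguments, zero for a negative lower argument. -/
def intChoose (r k : ℤ) : ℤ := if k < 0 then 0 else Ring.choose r k.toNat

lemma intChoose_of_neg {r k : ℤ} (hk : k < 0) : intChoose r k = 0 := if_pos hk

lemma intChoose_natCast (p q : ℕ) : intChoose p q = (p.choose q : ℤ) := by
  simp [intChoose, Ring.choose_natCast]

lemma intChoose_pascal (r k : ℤ) :
    intChoose (r + 1) k = intChoose r (k - 1) + intChoose r k := by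
  rcases lt_trichotomy k 0 with hk | rfl | hk
  · simp [intChoose_of_neg hk, intChoose_of_neg (show k - 1 < 0 by omega)]
  · simp [intChoose]
  · obtain ⟨j, rfl⟩ : ∃ j : ℕ, k = j + 1 := ⟨(k - 1).toNat, by omega⟩
    have e : ((j : ℤ) + 1).toNat = j + 1 := by omega
    simp [intChoose, e, Ring.choose_succ_succ, show ¬ ((j : ℤ) + 1 < 0) by omega]

lemma C_eq_intChoose {p q : ℤ} (hp : 0 ≤ p) (hq : 0 ≤ q) : C p q = intChoose p q := by
  lift p to ℕ using hp
  lift q to ℕ using hq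
  simp [C, intChoose_natCast]

lemma mul_intChoose_pred {p q : ℤ} (hp : 0 < p) (hq : 0 ≤ q) :
    p * intChoose (p - 1) (q - 1) = q * intChoose p q := by
  obtain ⟨i, rfl⟩ : ∃ i : ℕ, p = i + 1 := ⟨(p - 1).toNat, by omega⟩
  rcases hq.eq_or_lt with rfl | hq
  · simp [intChoose_of_neg]
  · obtain ⟨j, rfl⟩ : ∃ j : ℕ, q = j + 1 := ⟨(q - 1).toNat, by omega⟩
    have := Nat.add_one_mul_choose_eq i j
    have h2 := intChoose_natCast (i + 1) (j + 1)
    push_cast at h2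
    rw [add_sub_cancel_right, add_sub_cancel_right, intChoose_natCast, h2]
    exact_mod_cast this.trans (mul_comm _ _)

lemma mul_intChoose_pred_right {p q : ℤ} (hp : 0 < p) (hq : 0 ≤ q) :
    p * intChoose (p + q - 1) (q - 1) = q * intChoose (p + q - 1) q := by
  rcases hq.eq_or_lt with rfl | hq
  · simp [intChoose_of_neg]
  · have h1 := mul_intChoose_pred (show 0 < p + q by omega) hq.le
    have h2 := intChoose_pascal (p + q - 1) q
    rw [sub_add_cancel] at h2
    rw [h2] at h1
    linarith

/-- The number of first-passage paths, in terms of `M = h + m (y + d + c)`. -/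
def passageCount (m M y d c : ℤ) : ℤ :=
  intChoose (M - c - 1) d * (intChoose (M + y - 1) y - m * intChoose (M + y - 1) (y - 1))
    - m * intChoose (M - c - 2) (d - 1) * intChoose (M + y - 1) y

lemma passageCount_sub (m M y d c : ℤ) :
    passageCount m M y d c - passageCount m M (y - 1) d c
      = passageCount m (M - 1) y d (c - 1) := by
  have h1 := intChoose_pascal (M + y - 2) y
  have h2 := intChoose_pascal (M + y - 2) (y - 1)
  have e1 : M + y - 2 + 1 = M + y - 1 := by ring
  rw [e1] at h1 h2
  have e2 : M + (y - 1) - 1 = M + y - 2 := by ring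
  have e3 : M - 1 + y - 1 = M + y - 2 := by ring
  have e4 : M - 1 - (c - 1) - 1 = M - c - 1 := by ring
  have e5 : M - 1 - (c - 1) - 2 = M - c - 2 := by ring
  simp only [passageCount, e2, e3, e4, e5, h1, h2]
  ring

lemma passageCount_pascal (m M y d c : ℤ) :
    passageCount m M y d (c - 1) = passageCount m M y d c + passageCount m M y (d - 1) c := by
  have h1 := intChoose_pascal (M - c - 1) d
  have h2 := intChoose_pascal (M - c - 2) (d - 1)
  have e1 : M - (c - 1) - 1 = M - c - 1 + 1 := by ring
  have e2 : M - (c - 1) - 2 = M - c - 2 + 1 := by ring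
  simp only [passageCount, e1, e2, h1, h2]
  ring

lemma passageCount_boundary {m y d : ℤ} (hm : 0 < m) (hy : 0 ≤ y) (hd : 0 ≤ d) :
    passageCount m (m * (y + d)) y d (-1) = if y = 0 ∧ d = 0 then 1 else 0 := by
  split_ifs with hz
  · obtain ⟨rfl, rfl⟩ := hz
    simp [passageCount, intChoose]
  · have hM : 0 < m * (y + d) := mul_pos hm (by omega)
    set M := m * (y + d) with hMdef
    have h1 := mul_intChoose_pred hM hd
    have h2 := mul_intChoose_pred_right hM hy
    have e1 : M - -1 - 1 = M := by ring
    have e2 : M - -1 - 2 = M - 1 := by ring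
    refine (mul_eq_zero.mp (?_ : M * _ = 0)).resolve_left hM.ne'
    simp only [passageCount, e1, e2]
    linear_combination (-m * intChoose M d) * h2 - m * intChoose (M + y - 1) y * h1
      + intChoose M d * intChoose (M + y - 1) y * hMdef

lemma ncard_image_cons_union {A B D : Set (List Step)} (hA : A.Finite) (hB : B.Finite)
    (hD : D.Finite) :
    (List.cons Step.N '' A ∪ (List.cons Step.E '' B ∪ List.cons Step.D '' D)).ncard
      = A.ncard + (B.ncard + D.ncard) := by
  have hinj : ∀ s : Step, Function.Injective (List.cons s) := fun s => List.cons_injective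
  rw [Set.ncard_union_eq _ (hA.image _) ((hB.image _).union (hD.image _)),
    Set.ncard_union_eq _ (hB.image _) (hD.image _), Set.ncard_image_of_injective _ (hinj _),
    Set.ncard_image_of_injective _ (hinj _), Set.ncard_image_of_injective _ (hinj _)]
  · rw [Set.disjoint_left]
    rintro _ ⟨l, -, rfl⟩
    simp
  · rw [Set.disjoint_left]
    rintro _ ⟨l, -, rfl⟩
    simp

lemma passages_finite_and_ncard {m : ℤ} (hm : 0 < m) (k : ℕ) :
    ∀ {h y d c : ℤ}, 0 < h → 0 ≤ c → h + m * (y + d + c) + y ≤ k →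
      (passages m h y d c).Finite ∧
        ((passages m h y d c).ncard : ℤ) = passageCount m (h + m * (y + d + c)) y d c := by
  induction k with
  | zero =>
    intro h y d c hh hc hk
    have hneg : y < 0 ∨ d < 0 := by
      by_contra! hcon
      have : 0 ≤ m * (y + d + c) := mul_nonneg hm.le (by omega)
      push_cast at hk
      omega
    rw [passages_eq_empty (by tauto)]
    rcases hneg with hy | hd
    · simp [passageCount, intChoose_of_neg hy, intChoose_of_neg (show y - 1 < 0 by omega)]
    · simp [passageCount, intChoose_of_neg hd, intChoose_of_neg (show d - 1 < 0 by omega)]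
  | succ k ih =>
    intro h y d c hh hc hk
    by_cases hneg : y < 0 ∨ d < 0
    · rw [passages_eq_empty (by tauto)]
      rcases hneg with hy | hd
      · simp [passageCount, intChoose_of_neg hy, intChoose_of_neg (show y - 1 < 0 by omega)]
      · simp [passageCount, intChoose_of_neg hd, intChoose_of_neg (show d - 1 < 0 by omega)]
    push Not at hneg
    obtain ⟨hy, hd⟩ := hneg
    push_cast at hk
    obtain ⟨fN, cN⟩ := @ih (h + m) (y - 1) d c (by omega) hc (by linarith)
    have eN : h + m + m * (y - 1 + d + c) = h + m * (y + d + c) := by ring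
    rw [eN] at cN
    have hsub := passageCount_sub m (h + m * (y + d + c)) y d c
    rw [passages_eq_union hh]
    by_cases h1 : h = 1
    · rw [if_pos h1]
      subst h1
      have fE : (passages m (1 - 1) y d c).Finite := by
        rw [sub_self, passages_zero]
        split_ifs <;> simp
      have eM : 1 + m * (y + d + c) - 1 = m * (y + d + c) := by ring
      rw [eM] at hsub
      rcases hc.eq_or_lt with rfl | hc
      · have hD : passages m (1 + m - 1) y d (0 - 1) = ∅ := passages_eq_empty (by omega)
        have hb := passageCount_boundary hm hy hd
        rw [hD]
        refine ⟨(fN.image _).union ((fE.image _).union (by simp)), ?_⟩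
        rw [ncard_image_cons_union fN fE Set.finite_empty]
        push_cast
        rw [cN, passages_zero]
        rw [zero_sub, add_zero, hb] at hsub
        rw [add_zero]
        split_ifs at hsub ⊢ <;> first | (exfalso; tauto) | (simp; linarith)
      · obtain ⟨fD, cD⟩ := @ih (1 + m - 1) y d (c - 1) (by omega) (by omega) (by linarith)
        have eD : 1 + m - 1 + m * (y + d + (c - 1)) = m * (y + d + c) := by ring
        rw [eD] at cD
        refine ⟨(fN.image _).union ((fE.image _).union (fD.image _)), ?_⟩
        rw [ncard_image_cons_union fN fE fD]
        push_cast
        rw [cN, cD, passages_zero, if_neg (by omega)]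
        simp
        linarith
    · rw [if_neg h1]
      obtain ⟨fE, cE⟩ := @ih (h - 1) y d c (by omega) hc (by linarith)
      obtain ⟨fD, cD⟩ := @ih (h + m - 1) y (d - 1) c (by omega) hc (by linarith)
      have eE : h - 1 + m * (y + d + c) = h + m * (y + d + c) - 1 := by ring
      have eD : h + m - 1 + m * (y + (d - 1) + c) = h + m * (y + d + c) - 1 := by ring
      rw [eE] at cE
      rw [eD] at cD
      refine ⟨(fN.image _).union ((fE.image _).union (fD.image _)), ?_⟩
      rw [ncard_image_cons_union fN fE fD]
      push_cast
      rw [cN, cE, cD]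
      rw [passageCount_pascal] at hsub
      linarith

lemma firstPassage_replicate_append {m h : ℤ} (hm : 0 < m) (hh : 0 < h) (j : ℕ)
    (l : List Step) :
    FirstPassage m h (List.replicate j .N ++ l) ↔ FirstPassage m (h + m * j) l := by
  induction j generalizing h with
  | zero => simp
  | succ j ih =>
    rw [List.replicate_succ, List.cons_append, FirstPassage, rise, ih (by omega)]
    push_cast
    rw [show h + m + m * (j : ℤ) = h + m * (j + 1) by ring]
    simp [hh]

lemma cornered_replicate_append (m h : ℤ) (j : ℕ) (l : List Step) :
    cornered m h (List.replicate j .N ++ l) = cornered m (h + m * j) l := by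
  induction j generalizing h with
  | zero => simp
  | succ j ih =>
    rw [List.replicate_succ, List.cons_append, cornered, rise, ih]
    push_cast
    rw [show h + m + m * (j : ℤ) = h + m * (j + 1) by ring]
    simp

lemma positive_cons_iff_firstPassage {m : ℤ} (l : List Step) :
    ((m * (pt (.N :: l) (Step.N :: l).length).2 = (pt (.N :: l) (Step.N :: l).length).1) ∧
      AboveLine m (.N :: l) ∧ IsPositive m (.N :: l)) ↔ FirstPassage m m l := by
  have key : ∀ k, m * (pt (.N :: l) (k + 1)).2 - (pt (.N :: l) (k + 1)).1
      = m + (m * (pt l k).2 - (pt l k).1) := by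
    intro k
    rw [pt_cons_succ]
    simp [stepVec]
    ring
  rw [firstPassage_iff, List.length_cons]
  constructor
  · rintro ⟨h1, h2, h3⟩
    refine ⟨fun k hk => ?_, by have := key l.length; linarith⟩
    have a1 := h2 (k + 1)
    have a2 := h3 (k + 1) (by omega) (by simpa using hk)
    have := key k
    omega
  · rintro ⟨h1, h2⟩
    have hend := key l.length
    refine ⟨by linarith, fun k => ?_, fun k hk hk' => ?_⟩
    · rcases k with _ | k
      · simp [pt_zero]
      · rcases lt_or_ge k l.length with hk | hk
        · have := key k
          have := h1 k hk
          linarith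
        · have e : pt l k = pt l l.length := by simp [pt, List.take_of_length_le hk]
          have := key k
          rw [e] at this
          linarith
    · obtain ⟨k, rfl⟩ : ∃ j, k = j + 1 := ⟨k - 1, by omega⟩
      have := key k
      have := h1 k (by simpa using hk')
      intro hcon
      linarith

lemma positive_schroeder_eq_image {m n t a b : ℤ} (hm : 0 < m) (ht : 0 < t) :
    {S : List Step | IsSchroeder m n t S ∧ IsPositive m S ∧ (dg S : ℤ) = a ∧
        (cd m S : ℤ) = b}
      = (List.replicate t.toNat Step.N ++ ·) '' passages m (m * t) (n - t - a) (a - b) b := by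
  obtain ⟨j, rfl⟩ : ∃ j : ℕ, t = j + 1 := ⟨(t - 1).toNat, by omega⟩
  have hj : ((j : ℤ) + 1).toNat = j + 1 := by omega
  have main : ∀ l : List Step,
      (IsSchroeder m n (j + 1) (List.replicate (j + 1) Step.N ++ l) ∧
        IsPositive m (List.replicate (j + 1) Step.N ++ l) ∧
        (dg (List.replicate (j + 1) Step.N ++ l) : ℤ) = a ∧
        (cd m (List.replicate (j + 1) Step.N ++ l) : ℤ) = b) ↔
      l ∈ passages m (m * (j + 1)) (n - (j + 1) - a) (a - b) b := by
    intro l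
    have hfp := positive_cons_iff_firstPassage (m := m) (List.replicate j Step.N ++ l)
    rw [firstPassage_replicate_append hm hm, ← List.cons_append, ← List.replicate_succ,
      show m + m * (j : ℤ) = m * (j + 1) by ring] at hfp
    have hstart : StartsNorth (j + 1) (List.replicate (j + 1) Step.N ++ l) := by
      rw [StartsNorth, hj]
      exact List.prefix_append _ _
    have hN : (List.replicate (j + 1) Step.N ++ l).count .N = j + 1 + l.count .N := by simp
    have hD : (List.replicate (j + 1) Step.N ++ l).count .D = l.count .D := by
      simp [List.count_replicate]
    have hlen := pt_length (List.replicate (j + 1) Step.N ++ l)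
    rw [hN, hD] at hlen
    have hcd : cd m (List.replicate (j + 1) Step.N ++ l) = cornered m (m * (j + 1)) l := by
      rw [cd_eq_cornered, cornered_replicate_append]
      simp
    rw [dg_eq_count, hcd, hD]
    simp only [passages, Set.mem_ofPred_eq, IsSchroeder, ← hfp]
    constructor
    · rintro ⟨⟨-, h2, h3⟩, h4, h5, h6⟩
      refine ⟨⟨by rw [h2], h3, h4⟩, ?_, by omega, h6⟩
      rw [hlen] at h2
      have := congrArg Prod.snd h2
      push_cast at this
      omega
    · rintro ⟨⟨h2, h3, h4⟩, h5, h6, h7⟩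
      refine ⟨⟨hstart, ?_, h3⟩, h4, by omega, h7⟩
      have hsnd : (pt (List.replicate (j + 1) Step.N ++ l)
          (List.replicate (j + 1) Step.N ++ l).length).2 = n := by
        rw [hlen]
        push_cast
        omega
      rw [hsnd] at h2
      exact Prod.ext h2.symm hsnd
  rw [hj]
  ext S
  constructor
  · intro hS
    obtain ⟨l, rfl⟩ : List.replicate (j + 1) Step.N <+: S := by
      have := hS.1.1
      rwa [StartsNorth, hj] at this
    exact ⟨l, (main l).1 hS, rfl⟩
  · rintro ⟨l, hl, rfl⟩
    exact (main l).2 hl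

lemma passageCount_eq {m n y d c : ℤ} (hM : 0 < m * n) (hy : 0 ≤ y) (hd : 0 ≤ d)
    (hp : 0 < m * n - c - 1) :
    (passageCount m (m * n) y d c : ℚ)
      = (((n - y : ℤ) : ℚ) / n - ((m * d : ℤ) : ℚ) / ((m * n - c - 1 : ℤ) : ℚ))
        * (intChoose (m * n - c - 1) d : ℚ) * (intChoose (m * n + y - 1) y : ℚ) := by
  have h1 := mul_intChoose_pred hp hd
  have h2 := mul_intChoose_pred_right hM hy
  rw [show m * n - c - 1 - 1 = m * n - c - 2 by ring] at h1
  have hn : (n : ℚ) ≠ 0 := by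
    rintro h
    rw [Int.cast_eq_zero] at h
    simp [h] at hM
  have hm : (m : ℚ) ≠ 0 := by
    rintro h
    rw [Int.cast_eq_zero] at h
    simp [h] at hM
  have hp' : ((m * n - c - 1 : ℤ) : ℚ) ≠ 0 := by exact_mod_cast hp.ne'
  have h1' : ((m * n - c - 1 : ℤ) : ℚ) * (intChoose (m * n - c - 2) (d - 1) : ℚ)
      = d * (intChoose (m * n - c - 1) d : ℚ) := by exact_mod_cast h1
  have h2' : (m * n : ℚ) * (intChoose (m * n + y - 1) (y - 1) : ℚ)
      = y * (intChoose (m * n + y - 1) y : ℚ) := by exact_mod_cast h2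
  have h3 : (intChoose (m * n - c - 2) (d - 1) : ℚ)
      = d * (intChoose (m * n - c - 1) d : ℚ) / ((m * n - c - 1 : ℤ) : ℚ) := by
    rw [eq_div_iff hp', ← h1', mul_comm]
  have h4 : (intChoose (m * n + y - 1) (y - 1) : ℚ)
      = y * (intChoose (m * n + y - 1) y : ℚ) / (m * n) := by
    rw [eq_div_iff (mul_ne_zero hm hn), ← h2', mul_comm]
  rw [passageCount, Int.cast_sub, Int.cast_mul, Int.cast_sub, Int.cast_mul, Int.cast_mul,
    Int.cast_mul, h3, h4]
  generalize ((m * n - c - 1 : ℤ) : ℚ) = p at *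
  push_cast
  field_simp

/-- the number of positive `(m,t)`-Schröder paths of height `n` with `a`
diagonal steps and `b` cornered diagonal steps. -/
theorem statement8 (m n t a b : ℤ) (hm : 0 < m) (hn : 0 < n) (ht : 0 < t)
    (hb : 0 ≤ b) (hba : b ≤ a) (ha : a ≤ n - t) (hne : m * n - b - 1 ≠ 0) :
    (({S : List Step | IsSchroeder m n t S ∧ IsPositive m S ∧ (dg S : ℤ) = a ∧
        (cd m S : ℤ) = b}.ncard : ℚ))
      = (((t + a : ℤ) : ℚ) / ((n : ℤ) : ℚ)
          - ((m * (a - b) : ℤ) : ℚ) / ((m * n - b - 1 : ℤ) : ℚ))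
        * ((C (m * n - b - 1) (a - b) : ℤ) : ℚ)
        * ((C (m * n + n - t - a - 1) (n - t - a) : ℤ) : ℚ) := by
  have hp : 0 < m * n - b - 1 := by
    have : n ≤ m * n := le_mul_of_one_le_left hn.le hm
    omega
  have hM : m * t + m * (n - t - a + (a - b) + b) = m * n := by ring
  have hcard := (passages_finite_and_ncard hm
    (m * t + m * (n - t - a + (a - b) + b) + (n - t - a)).toNat (h := m * t) (y := n - t - a)
    (d := a - b) (c := b) (mul_pos hm ht) hb (Int.self_le_toNat _)).2
  rw [hM] at hcard
  have hform := passageCount_eq (mul_pos hm hn) (show 0 ≤ n - t - a by omega)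
    (show 0 ≤ a - b by omega) hp
  rw [positive_schroeder_eq_image hm ht,
    Set.ncard_image_of_injective _ (List.append_right_injective _),
    C_eq_intChoose hp.le (by omega),
    C_eq_intChoose (by have := mul_pos hm hn; omega) (by omega)]
  rw [← hcard, Int.cast_natCast] at hform
  rw [hform, show n - (n - t - a) = t + a by ring,
    show m * n + (n - t - a) - 1 = m * n + n - t - a - 1 by ring]
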